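/- arXiv:2201.04215 — 3 statements merged into one kernel-verified Lean document; each statement's English description precedes it below -/
import Mathlib

section
/- Energy identity for fully nonlinear degenerate parabolic equations (core identity of Theorem 1, Dirichlet-type boundary behaviour). Let $f : [0,1]\times\mathbb{R}^4 \to \mathbb{R}$ be continuously differentiable, with arguments written $f(x,u,p,q,r)$ and $f_q$ denoting the partial derivative of $f$ with respect to its fourth argument. Define $F^1(x,u,p,q,r) := f(x,u,p,0,0) + f_q(x,u,p,0,0)\,q - f(x,u,p,q,r)$. Let $g : [0,1]\times\mathbb{R}^2 \to \mathbb{R}$ be continuous and let $L : [0,1]\times\mathbb{R}^2 \to \mathbb{R}$, written $L = L(x,u,p)$, be twice continuously differentiable and satisfy for all $(x,u,p)$: (i) $L_{pp}(x,u,p) = f_q(x,u,p,0,0)\,e^{g(x,u,p)}$, and (ii) $L_u(x,u,p) - L_{px}(x,u,p) - p\,L_{pu}(x,u,p) = -e^{g(x,u,p)} f(x,u,p,0,0)$. Let $T > 0$ and let $u : [0,T]\times[0,1] \to \mathbb{R}$ be twice continuously differentiable, satisfy $f(x, u, u_x, u_{xx}, u_t) = 0$ at every point of $[0,T]\times[0,1]$,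 and satisfy $u_t(t,0) = u_t(t,1) = 0$ for all $t$. Then for every $t \in (0,T)$ the function $E(t) := \int_0^1 L(x, u(t,x), u_x(t,x))\,dx$ is differentiable and $E'(t) = -\int_0^1 e^{g(x,u,u_x)}\, F^1(x, u, u_x, u_{xx}, u_t)\, u_t \, dx$. -/
open Real Set

/-- Partial derivative of `u(t,x)` with respect to time `t`. -/
noncomputable def pt (u : ℝ → ℝ → ℝ) (t x : ℝ) : ℝ := deriv (fun s => u s x) t

/-- Partial derivative of `u(t,x)` with respect to space `x`. -/
noncomputable def px (u : ℝ → ℝ → ℝ) (t x : ℝ) : ℝ := deriv (fun y => u t y) x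

/-- Second partial derivative of `u(t,x)` with respect to space `x`. -/
noncomputable def pxx (u : ℝ → ℝ → ℝ) (t x : ℝ) : ℝ := deriv (fun y => px u t y) x

/-- `f_q(x,u,p,0,0)`: partial derivative of `f(x,u,p,q,r)` in its fourth slot,
evaluated at `q = r = 0`. -/
noncomputable def fq0 (f : ℝ → ℝ → ℝ → ℝ → ℝ → ℝ) (x u p : ℝ) : ℝ :=
  deriv (fun q => f x u p q 0) 0

/-- `F¹(x,u,p,q,r) := f(x,u,p,0,0) + f_q(x,u,p,0,0) q - f(x,u,p,q,r)`. -/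
noncomputable def F1 (f : ℝ → ℝ → ℝ → ℝ → ℝ → ℝ) (x u p q r : ℝ) : ℝ :=
  f x u p 0 0 + fq0 f x u p * q - f x u p q r

/-- `L_p(x,u,p)`. -/
noncomputable def Lp (L : ℝ → ℝ → ℝ → ℝ) (x u p : ℝ) : ℝ := deriv (fun p' => L x u p') p

/-- `L_pp(x,u,p)`. -/
noncomputable def Lpp (L : ℝ → ℝ → ℝ → ℝ) (x u p : ℝ) : ℝ := deriv (fun p' => Lp L x u p') p

/-- `L_u(x,u,p)`. -/
noncomputable def Lu (L : ℝ → ℝ → ℝ → ℝ) (x u p : ℝ) : ℝ := deriv (fun u' => L x u' p) u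

/-- `L_px(x,u,p)`. -/
noncomputable def Lpx (L : ℝ → ℝ → ℝ → ℝ) (x u p : ℝ) : ℝ := deriv (fun x' => Lp L x' u p) x

/-- `L_pu(x,u,p)`. -/
noncomputable def Lpu (L : ℝ → ℝ → ℝ → ℝ) (x u p : ℝ) : ℝ := deriv (fun u' => Lp L x u' p) u

theorem hasDerivAt_left_of_differentiable {U : ℝ × ℝ → ℝ} (hU : Differentiable ℝ U) (t x : ℝ) :
    HasDerivAt (fun s => U (s, x)) (fderiv ℝ U (t, x) (1, 0)) t :=
  (hU (t, x)).hasFDerivAt.comp_hasDerivAt t ((hasDerivAt_id t).prodMk (hasDerivAt_const t x))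

theorem hasDerivAt_right_of_differentiable {U : ℝ × ℝ → ℝ} (hU : Differentiable ℝ U) (t x : ℝ) :
    HasDerivAt (fun y => U (t, y)) (fderiv ℝ U (t, x) (0, 1)) x :=
  (hU (t, x)).hasFDerivAt.comp_hasDerivAt x ((hasDerivAt_const x t).prodMk (hasDerivAt_id x))

theorem hasDerivAt_first_of_differentiable {G : ℝ → ℝ → ℝ → ℝ}
    (hG : Differentiable ℝ (fun v : ℝ × ℝ × ℝ => G v.1 v.2.1 v.2.2)) (a b c : ℝ) :
    HasDerivAt (fun y => G y b c)
      (fderiv ℝ (fun v : ℝ × ℝ × ℝ => G v.1 v.2.1 v.2.2) (a, b, c) (1, 0, 0)) a :=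
  HasFDerivAt.comp_hasDerivAt (f := fun y => (y, b, c)) a
    (hG (a, b, c)).hasFDerivAt
    ((hasDerivAt_id a).prodMk ((hasDerivAt_const a b).prodMk (hasDerivAt_const a c)))

theorem hasDerivAt_second_of_differentiable {G : ℝ → ℝ → ℝ → ℝ}
    (hG : Differentiable ℝ (fun v : ℝ × ℝ × ℝ => G v.1 v.2.1 v.2.2)) (a b c : ℝ) :
    HasDerivAt (fun y => G a y c)
      (fderiv ℝ (fun v : ℝ × ℝ × ℝ => G v.1 v.2.1 v.2.2) (a, b, c) (0, 1, 0)) b :=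
  HasFDerivAt.comp_hasDerivAt (f := fun y => (a, y, c)) b
    (hG (a, b, c)).hasFDerivAt
    ((hasDerivAt_const b a).prodMk ((hasDerivAt_id b).prodMk (hasDerivAt_const b c)))

theorem hasDerivAt_third_of_differentiable {G : ℝ → ℝ → ℝ → ℝ}
    (hG : Differentiable ℝ (fun v : ℝ × ℝ × ℝ => G v.1 v.2.1 v.2.2)) (a b c : ℝ) :
    HasDerivAt (fun y => G a b y)
      (fderiv ℝ (fun v : ℝ × ℝ × ℝ => G v.1 v.2.1 v.2.2) (a, b, c) (0, 0, 1)) c :=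
  HasFDerivAt.comp_hasDerivAt (f := fun y => (a, b, y)) c
    (hG (a, b, c)).hasFDerivAt
    ((hasDerivAt_const c a).prodMk ((hasDerivAt_const c b).prodMk (hasDerivAt_id c)))

/-- Chain rule along a curve for a function of three real variables, in terms of partial
derivatives. -/
theorem hasDerivAt_comp_three {G : ℝ → ℝ → ℝ → ℝ}
    (hG : Differentiable ℝ (fun v : ℝ × ℝ × ℝ => G v.1 v.2.1 v.2.2))
    {a b c : ℝ → ℝ} {a' b' c' s : ℝ}
    (ha : HasDerivAt a a' s) (hb : HasDerivAt b b' s) (hc : HasDerivAt c c' s) :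
    HasDerivAt (fun r => G (a r) (b r) (c r))
      (a' * deriv (fun y => G y (b s) (c s)) (a s) + b' * deriv (fun y => G (a s) y (c s)) (b s) +
        c' * deriv (fun y => G (a s) (b s) y) (c s)) s := by
  have h := HasFDerivAt.comp_hasDerivAt (f := fun r => (a r, b r, c r)) s
    (hG (a s, b s, c s)).hasFDerivAt (ha.prodMk (hb.prodMk hc))
  have hv : ((a', b', c') : ℝ × ℝ × ℝ) =
      a' • (1, 0, 0) + b' • (0, 1, 0) + c' • (0, 0, 1) := by simp
  rw [hv, map_add, map_add, map_smul, map_smul, map_smul] at h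
  rw [(hasDerivAt_first_of_differentiable hG _ _ _).deriv,
    (hasDerivAt_second_of_differentiable hG _ _ _).deriv,
    (hasDerivAt_third_of_differentiable hG _ _ _).deriv]
  exact h

/-- Differentiation under the integral sign for a jointly `C¹` integrand on a compact interval. -/
theorem hasDerivAt_integral_of_contDiff_one {G : ℝ × ℝ → ℝ} (hG : ContDiff ℝ 1 G)
    (a b t : ℝ) :
    HasDerivAt (fun s => ∫ x in a..b, G (s, x)) (∫ x in a..b, fderiv ℝ G (t, x) (1, 0)) t := by
  have hc : Continuous fun q : ℝ × ℝ => fderiv ℝ G q (1, 0) :=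
    (hG.continuous_fderiv one_ne_zero).clm_apply continuous_const
  obtain ⟨C, hC⟩ := ((isCompact_Icc (a := t - 1) (b := t + 1)).prod
    (isCompact_uIcc (a := a) (b := b))).exists_bound_of_continuousOn hc.continuousOn
  have hGx (s : ℝ) : Continuous fun x => G (s, x) := hG.continuous.comp (by fun_prop)
  refine (intervalIntegral.hasDerivAt_integral_of_dominated_loc_of_deriv_le
    (F := fun s x => G (s, x)) (F' := fun s x => fderiv ℝ G (s, x) (1, 0)) (bound := fun _ => C)
    (Icc_mem_nhds (sub_one_lt t) (lt_add_one t))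
    (Filter.Eventually.of_forall fun s => (hGx s).aestronglyMeasurable)
    ((hGx t).intervalIntegrable a b)
    (hc.comp (by fun_prop : Continuous fun x : ℝ => (t, x))).aestronglyMeasurable
    (Filter.Eventually.of_forall fun x hx s hs => hC (s, x) ⟨hs, uIoc_subset_uIcc hx⟩)
    intervalIntegrable_const
    (Filter.Eventually.of_forall fun x _ s _ =>
      hasDerivAt_left_of_differentiable (hG.differentiable one_ne_zero) s x)).2

section PartialDerivatives

variable {u : ℝ → ℝ → ℝ}

theorem hasDerivAt_pt (hu : Differentiable ℝ (fun q : ℝ × ℝ => u q.1 q.2)) (t x : ℝ) :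
    HasDerivAt (fun s => u s x) (pt u t x) t :=
  (hasDerivAt_left_of_differentiable hu t x).differentiableAt.hasDerivAt

theorem hasDerivAt_px (hu : Differentiable ℝ (fun q : ℝ × ℝ => u q.1 q.2)) (t x : ℝ) :
    HasDerivAt (fun y => u t y) (px u t x) x :=
  (hasDerivAt_right_of_differentiable hu t x).differentiableAt.hasDerivAt

theorem pt_eq_fderiv (hu : Differentiable ℝ (fun q : ℝ × ℝ => u q.1 q.2)) :
    (fun q : ℝ × ℝ => pt u q.1 q.2) =
      fun q => fderiv ℝ (fun q : ℝ × ℝ => u q.1 q.2) q (1, 0) :=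
  funext fun q => (hasDerivAt_left_of_differentiable hu q.1 q.2).deriv

theorem px_eq_fderiv (hu : Differentiable ℝ (fun q : ℝ × ℝ => u q.1 q.2)) :
    (fun q : ℝ × ℝ => px u q.1 q.2) =
      fun q => fderiv ℝ (fun q : ℝ × ℝ => u q.1 q.2) q (0, 1) :=
  funext fun q => (hasDerivAt_right_of_differentiable hu q.1 q.2).deriv

theorem contDiff_pt (hu : ContDiff ℝ 2 (fun q : ℝ × ℝ => u q.1 q.2)) :
    ContDiff ℝ 1 (fun q : ℝ × ℝ => pt u q.1 q.2) := by
  rw [pt_eq_fderiv (hu.differentiable two_ne_zero)]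
  exact (hu.fderiv_right (m := 1) (by norm_num)).clm_apply contDiff_const

theorem contDiff_px (hu : ContDiff ℝ 2 (fun q : ℝ × ℝ => u q.1 q.2)) :
    ContDiff ℝ 1 (fun q : ℝ × ℝ => px u q.1 q.2) := by
  rw [px_eq_fderiv (hu.differentiable two_ne_zero)]
  exact (hu.fderiv_right (m := 1) (by norm_num)).clm_apply contDiff_const

/-- Symmetry of the mixed second partial derivatives. -/
theorem pt_px_comm (hu : ContDiff ℝ 2 (fun q : ℝ × ℝ => u q.1 q.2)) (t x : ℝ) :
    pt (px u) t x = px (pt u) t x := by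
  have hd := hu.differentiable two_ne_zero
  have hsymm := (hu.contDiffAt (x := (t, x))).isSymmSndFDerivAt (by simp)
  have hd' : Differentiable ℝ (fderiv ℝ (fun q : ℝ × ℝ => u q.1 q.2)) :=
    (hu.fderiv_right (m := 1) (by norm_num)).differentiable one_ne_zero
  have h1 := congrFun (pt_eq_fderiv ((contDiff_px hu).differentiable one_ne_zero)) (t, x)
  have h2 := congrFun (px_eq_fderiv ((contDiff_pt hu).differentiable one_ne_zero)) (t, x)
  simp only at h1 h2
  rw [h1, h2, px_eq_fderiv hd, pt_eq_fderiv hd,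
    fderiv_clm_apply (hd' _) (differentiableAt_const _),
    fderiv_clm_apply (hd' _) (differentiableAt_const _)]
  simpa using hsymm (1, 0) (0, 1)

end PartialDerivatives

theorem contDiff_Lp {L : ℝ → ℝ → ℝ → ℝ}
    (hL : ContDiff ℝ 2 (fun v : ℝ × ℝ × ℝ => L v.1 v.2.1 v.2.2)) :
    ContDiff ℝ 1 (fun v : ℝ × ℝ × ℝ => Lp L v.1 v.2.1 v.2.2) := by
  have h : (fun v : ℝ × ℝ × ℝ => Lp L v.1 v.2.1 v.2.2) =
      fun v => fderiv ℝ (fun v : ℝ × ℝ × ℝ => L v.1 v.2.1 v.2.2) v (0, 0, 1) :=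
    funext fun v => (hasDerivAt_third_of_differentiable
      (hL.differentiable two_ne_zero) v.1 v.2.1 v.2.2).deriv
  rw [h]
  exact (hL.fderiv_right (m := 1) (by norm_num)).clm_apply contDiff_const

theorem continuous_Lu {L : ℝ → ℝ → ℝ → ℝ}
    (hL : ContDiff ℝ 2 (fun v : ℝ × ℝ × ℝ => L v.1 v.2.1 v.2.2)) :
    Continuous (fun v : ℝ × ℝ × ℝ => Lu L v.1 v.2.1 v.2.2) := by
  have h : (fun v : ℝ × ℝ × ℝ => Lu L v.1 v.2.1 v.2.2) =
      fun v => fderiv ℝ (fun v : ℝ × ℝ × ℝ => L v.1 v.2.1 v.2.2) v (0, 1, 0) :=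
    funext fun v => (hasDerivAt_second_of_differentiable
      (hL.differentiable two_ne_zero) v.1 v.2.1 v.2.2).deriv
  rw [h]
  exact (hL.continuous_fderiv two_ne_zero).clm_apply continuous_const

/-- Energy identity for fully nonlinear degenerate parabolic equations
(core identity of Theorem 1, Dirichlet-type boundary behaviour). -/
theorem energy_identity_fully_nonlinear_dirichlet
    (f : ℝ → ℝ → ℝ → ℝ → ℝ → ℝ)
    (hf : ContDiff ℝ 1 (fun v : ℝ × ℝ × ℝ × ℝ × ℝ => f v.1 v.2.1 v.2.2.1 v.2.2.2.1 v.2.2.2.2))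
    (g : ℝ → ℝ → ℝ → ℝ)
    (hg : Continuous (fun v : ℝ × ℝ × ℝ => g v.1 v.2.1 v.2.2))
    (L : ℝ → ℝ → ℝ → ℝ)
    (hL : ContDiff ℝ 2 (fun v : ℝ × ℝ × ℝ => L v.1 v.2.1 v.2.2))
    (hLpp : ∀ x ∈ Icc (0:ℝ) 1, ∀ u p : ℝ,
      Lpp L x u p = fq0 f x u p * Real.exp (g x u p))
    (hLid : ∀ x ∈ Icc (0:ℝ) 1, ∀ u p : ℝ,
      Lu L x u p - Lpx L x u p - p * Lpu L x u p = -Real.exp (g x u p) * f x u p 0 0)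
    (T : ℝ) (hT : 0 < T)
    (u : ℝ → ℝ → ℝ)
    (hu : ContDiff ℝ 2 (fun q : ℝ × ℝ => u q.1 q.2))
    (hPDE : ∀ t ∈ Icc (0:ℝ) T, ∀ x ∈ Icc (0:ℝ) 1,
      f x (u t x) (px u t x) (pxx u t x) (pt u t x) = 0)
    (hBC : ∀ t ∈ Icc (0:ℝ) T, pt u t 0 = 0 ∧ pt u t 1 = 0) :
    ∀ t ∈ Ioo (0:ℝ) T,
      HasDerivAt (fun s => ∫ x in (0:ℝ)..1, L x (u s x) (px u s x))
        (-∫ x in (0:ℝ)..1,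
          Real.exp (g x (u t x) (px u t x)) *
            F1 f x (u t x) (px u t x) (pxx u t x) (pt u t x) * pt u t x) t := by
  intro t ht
  have htI := Ioo_subset_Icc_self ht
  have hud := hu.differentiable two_ne_zero
  have hpx := contDiff_px hu
  have hpxd := hpx.differentiable one_ne_zero
  have hpt := contDiff_pt hu
  have hLp := contDiff_Lp hL
  have hG : ContDiff ℝ 1 (fun q : ℝ × ℝ => L q.2 (u q.1 q.2) (px u q.1 q.2)) :=
    (hL.of_le one_le_two).comp
      (contDiff_snd.prodMk ((hu.of_le one_le_two).prodMk hpx))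
  have hM : ContDiff ℝ 1 (fun x : ℝ => Lp L x (u t x) (px u t x)) :=
    hLp.comp (contDiff_id.prodMk (((hu.of_le one_le_two).comp
      (contDiff_const.prodMk contDiff_id)).prodMk (hpx.comp (contDiff_const.prodMk contDiff_id))))
  have hQ : ContDiff ℝ 1 (fun x : ℝ => pt u t x) :=
    hpt.comp (contDiff_const.prodMk contDiff_id)
  have hLuc : Continuous (fun x : ℝ => Lu L x (u t x) (px u t x)) :=
    (continuous_Lu hL).comp (continuous_id.prodMk ((hu.continuous.comp
      (continuous_const.prodMk continuous_id)).prodMk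
        (hpx.continuous.comp (continuous_const.prodMk continuous_id))))
  have hMd (x : ℝ) : deriv (fun x => Lp L x (u t x) (px u t x)) x =
      Lpx L x (u t x) (px u t x) + px u t x * Lpu L x (u t x) (px u t x) +
        pxx u t x * Lpp L x (u t x) (px u t x) := by
    have h := (hasDerivAt_comp_three (hLp.differentiable one_ne_zero) (hasDerivAt_id x)
      (hasDerivAt_px hud t x) (hasDerivAt_px hpxd t x)).deriv
    rw [one_mul] at h
    exact h
  have hGt (x : ℝ) : fderiv ℝ (fun q : ℝ × ℝ => L q.2 (u q.1 q.2) (px u q.1 q.2)) (t, x) (1, 0) =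
      Lu L x (u t x) (px u t x) * pt u t x +
        Lp L x (u t x) (px u t x) * deriv (fun x => pt u t x) x := by
    have h := hasDerivAt_comp_three (hL.differentiable two_ne_zero) (hasDerivAt_const t x)
      (hasDerivAt_pt hud t x) (hasDerivAt_pt hpxd t x)
    rw [(hasDerivAt_left_of_differentiable (hG.differentiable one_ne_zero) t x).unique h,
      pt_px_comm hu]
    simp only [Lu, Lp, px]
    ring
  have hMc := hM.continuous_deriv_one
  have hQc := hQ.continuous_deriv_one
  have hparts := intervalIntegral.integral_mul_deriv_eq_deriv_mul (a := 0) (b := 1)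
    (fun x _ => (hM.differentiable one_ne_zero x).hasDerivAt)
    (fun x _ => (hQ.differentiable one_ne_zero x).hasDerivAt)
    (hMc.intervalIntegrable _ _) (hQc.intervalIntegrable _ _)
  rw [(hBC t htI).1, (hBC t htI).2, mul_zero, mul_zero, sub_zero, zero_sub] at hparts
  convert hasDerivAt_integral_of_contDiff_one hG 0 1 t using 1
  have hi₁ : IntervalIntegrable
      (fun x => Lu L x (u t x) (px u t x) * pt u t x) MeasureTheory.volume 0 1 :=
    (hLuc.mul hQ.continuous).intervalIntegrable _ _
  have hi₂ : IntervalIntegrable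
      (fun x => Lp L x (u t x) (px u t x) * deriv (fun x => pt u t x) x) MeasureTheory.volume 0 1 :=
    (hM.continuous.mul hQc).intervalIntegrable _ _
  have hi₃ : IntervalIntegrable
      (fun x => deriv (fun x => Lp L x (u t x) (px u t x)) x * pt u t x) MeasureTheory.volume 0 1 :=
    (hMc.mul hQ.continuous).intervalIntegrable _ _
  simp only [hGt]
  rw [intervalIntegral.integral_add hi₁ hi₂, hparts, ← sub_eq_add_neg,
    ← intervalIntegral.integral_sub hi₁ hi₃, ← intervalIntegral.integral_neg]
  refine intervalIntegral.integral_congr fun x hx => ?_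
  rw [uIcc_of_le zero_le_one] at hx
  simp only [hMd, F1, hPDE t htI x hx, hLpp x hx]
  linear_combination (-pt u t x) * hLid x hx (u t x) (px u t x)
end

section
/- Construction of the Lagrangian from a solution of the characteristic PDE. Let $A, B : [0,1]\times\mathbb{R}^2 \to \mathbb{R}$ and $g : [0,1]\times\mathbb{R}^2 \to \mathbb{R}$ be continuously differentiable, with arguments $(x,u,p)$, and assume $g$ satisfies the first-order PDE $A\,g_x + p\,A\,g_u + B\,g_p = -B_p - A_x - p\,A_u$ at every point of $[0,1]\times\mathbb{R}^2$. Define $L : [0,1]\times\mathbb{R}^2 \to \mathbb{R}$ by $L(x,u,p) := \int_0^p \int_0^{p_1} A(x,u,p_2)\,e^{g(x,u,p_2)}\,dp_2\,dp_1 + \int_0^u e^{g(x,u_1,0)}\,B(x,u_1,0)\,du_1$. Then the partial derivatives $L_u$, $L_p$, $L_{pp}$, $L_{px}$, $L_{pu}$ exist everywhere (one-sided in $x$ at $x=0,1$), $L_{pp}(x,u,p) = A(x,u,p)\,e^{g(x,u,p)}$, and $L$ satisfies $L_u(x,u,p) - L_{px}(x,u,p) - p\,L_{pu}(x,u,p)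 = e^{g(x,u,p)}\,B(x,u,p)$ for all $(x,u,p) \in [0,1]\times\mathbb{R}^2$. -/
open Real Set

/-- Partial derivative with respect to the first argument `x` of a function of `(x,u,p)`. -/
noncomputable def Dx (F : ℝ → ℝ → ℝ → ℝ) (x u p : ℝ) : ℝ := deriv (fun x' => F x' u p) x

/-- Partial derivative with respect to the second argument `u` of a function of `(x,u,p)`. -/
noncomputable def Du (F : ℝ → ℝ → ℝ → ℝ) (x u p : ℝ) : ℝ := deriv (fun u' => F x u' p) u

/-- Partial derivative with respect to the third argument `p` of a function of `(x,u,p)`. -/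
noncomputable def Dp (F : ℝ → ℝ → ℝ → ℝ) (x u p : ℝ) : ℝ := deriv (fun p' => F x u p') p

/-- The Lagrangian built from `A`, `B` and a solution `g` of the characteristic PDE:
`L(x,u,p) = ∫₀^p ∫₀^{p₁} A(x,u,p₂) e^{g(x,u,p₂)} dp₂ dp₁ + ∫₀^u e^{g(x,u₁,0)} B(x,u₁,0) du₁`. -/
noncomputable def LagL (A B g : ℝ → ℝ → ℝ → ℝ) (x u p : ℝ) : ℝ :=
  (∫ p1 in (0:ℝ)..p, ∫ p2 in (0:ℝ)..p1, A x u p2 * Real.exp (g x u p2))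
    + ∫ u1 in (0:ℝ)..u, Real.exp (g x u1 0) * B x u1 0

/-- Differentiation under the integral sign for a jointly continuous integrand with jointly
continuous partial derivative. -/
theorem hasDerivAt_intervalIntegral_of_continuous {F F' : ℝ → ℝ → ℝ}
    (hF : Continuous F.uncurry) (hF' : Continuous F'.uncurry)
    (h : ∀ t q, HasDerivAt (fun s => F s q) (F' t q) t) (a b t : ℝ) :
    HasDerivAt (fun s => ∫ q in a..b, F s q) (∫ q in a..b, F' t q) t := by
  have hK : IsCompact (Metric.closedBall t 1 ×ˢ uIcc a b) :=
    (isCompact_closedBall t 1).prod isCompact_uIcc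
  obtain ⟨C, hC⟩ := hK.exists_bound_of_continuousOn hF'.continuousOn
  have hFt : ∀ s, Continuous (F s) := fun s => hF.comp (Continuous.prodMk_right s)
  have hFt' : Continuous (F' t) := hF'.comp (Continuous.prodMk_right t)
  refine (intervalIntegral.hasDerivAt_integral_of_dominated_loc_of_deriv_le
    (bound := fun _ => C) (Metric.closedBall_mem_nhds t one_pos)
    (.of_forall fun s => (hFt s).aestronglyMeasurable) ((hFt t).intervalIntegrable a b)
    hFt'.aestronglyMeasurable (.of_forall fun q hq s hs => ?_)
    intervalIntegrable_const (.of_forall fun q _ s _ => h s q)).2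
  exact hC (s, q) ⟨hs, uIoc_subset_uIcc hq⟩

/-- A `C¹` function of three variables has jointly continuous partial derivatives. -/
theorem exists_continuous_partials {F : ℝ → ℝ → ℝ → ℝ}
    (hF : ContDiff ℝ 1 (fun v : ℝ × ℝ × ℝ => F v.1 v.2.1 v.2.2)) :
    ∃ Fx Fu Fp : ℝ → ℝ → ℝ → ℝ,
      Continuous (fun v : ℝ × ℝ × ℝ => Fx v.1 v.2.1 v.2.2) ∧
      Continuous (fun v : ℝ × ℝ × ℝ => Fu v.1 v.2.1 v.2.2) ∧
      (∀ x u p, HasDerivAt (fun x' => F x' u p) (Fx x u p) x) ∧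
      (∀ x u p, HasDerivAt (fun u' => F x u' p) (Fu x u p) u) ∧
      (∀ x u p, HasDerivAt (fun p' => F x u p') (Fp x u p) p) := by
  set f : ℝ × ℝ × ℝ → ℝ := fun v => F v.1 v.2.1 v.2.2
  have hc : Continuous (fderiv ℝ f) := hF.continuous_fderiv one_ne_zero
  have hd : ∀ v, HasFDerivAt f (fderiv ℝ f v) v :=
    fun v => (hF.differentiable one_ne_zero v).hasFDerivAt
  refine ⟨fun x u p => fderiv ℝ f (x, u, p) (1, 0, 0), fun x u p => fderiv ℝ f (x, u, p) (0, 1, 0),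
    fun x u p => fderiv ℝ f (x, u, p) (0, 0, 1), hc.clm_apply continuous_const,
    hc.clm_apply continuous_const, fun x u p => ?_, fun x u p => ?_, fun x u p => ?_⟩
  · exact (hd (x, u, p)).comp_hasDerivAt x
      ((hasDerivAt_id x).prodMk ((hasDerivAt_const x u).prodMk (hasDerivAt_const x p)))
  · exact (hd (x, u, p)).comp_hasDerivAt u
      ((hasDerivAt_const u x).prodMk ((hasDerivAt_id u).prodMk (hasDerivAt_const u p)))
  · exact (hd (x, u, p)).comp_hasDerivAt p
      ((hasDerivAt_const p x).prodMk ((hasDerivAt_const p u).prodMk (hasDerivAt_id p)))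

/-- An antiderivative identity along `p`: if `G' = -Fx - p Fu` then the integrated partial
derivatives of `F` recover `G p`. -/
theorem integral_sub_integral_eq_of_hasDerivAt {fx fu G : ℝ → ℝ}
    (hfx : Continuous fx) (hfu : Continuous fu)
    (hG : ∀ p, HasDerivAt G (-fx p - p * fu p) p) (p : ℝ) :
    (∫ q in (0:ℝ)..p, ∫ r in (0:ℝ)..q, fu r) + G 0 - (∫ q in (0:ℝ)..p, fx q)
      - p * (∫ q in (0:ℝ)..p, fu q) = G p := by
  have hprim : ∀ {f : ℝ → ℝ}, Continuous f → ∀ q,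
      HasDerivAt (fun q => ∫ r in (0:ℝ)..q, f r) (f q) q := fun hf q =>
    hf.integral_hasStrictDerivAt 0 q |>.hasDerivAt
  have hHu : Continuous (fun q => ∫ r in (0:ℝ)..q, fu r) :=
    continuous_iff_continuousAt.2 fun q => (hprim hfu q).continuousAt
  have hD : ∀ q, HasDerivAt (fun p => (∫ q in (0:ℝ)..p, ∫ r in (0:ℝ)..q, fu r)
      - (∫ q in (0:ℝ)..p, fx q) - p * (∫ q in (0:ℝ)..p, fu q) - G p) 0 q := fun q => by
    refine ((((hprim hHu q).sub (hprim hfx q)).sub ((hasDerivAt_id q).mul (hprim hfu q))).sub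
      (hG q)).congr_deriv ?_
    simp only [id]
    ring
  have := is_const_of_deriv_eq_zero (fun q => (hD q).differentiableAt) (fun q => (hD q).deriv) p 0
  simp only [intervalIntegral.integral_same] at this
  linarith

/-- Construction of the Lagrangian from a solution of the characteristic PDE. -/
theorem lagrangian_construction
    (A B g : ℝ → ℝ → ℝ → ℝ)
    (hA : ContDiff ℝ 1 (fun v : ℝ × ℝ × ℝ => A v.1 v.2.1 v.2.2))
    (hB : ContDiff ℝ 1 (fun v : ℝ × ℝ × ℝ => B v.1 v.2.1 v.2.2))
    (hgC : ContDiff ℝ 1 (fun v : ℝ × ℝ × ℝ => g v.1 v.2.1 v.2.2))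
    (hPDE : ∀ x ∈ Icc (0:ℝ) 1, ∀ u p : ℝ,
      A x u p * Dx g x u p + p * A x u p * Du g x u p + B x u p * Dp g x u p
        = -Dp B x u p - Dx A x u p - p * Du A x u p) :
    ∀ x ∈ Icc (0:ℝ) 1, ∀ u p : ℝ,
      -- existence of the partial derivatives L_u, L_p, L_pp, L_px, L_pu
      DifferentiableAt ℝ (fun u' => LagL A B g x u' p) u ∧
      DifferentiableAt ℝ (fun p' => LagL A B g x u p') p ∧
      DifferentiableAt ℝ (fun p' => Dp (LagL A B g) x u p') p ∧
      DifferentiableAt ℝ (fun x' => Dp (LagL A B g) x' u p) x ∧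
      DifferentiableAt ℝ (fun u' => Dp (LagL A B g) x u' p) u ∧
      -- L_pp = A e^g
      deriv (fun p' => Dp (LagL A B g) x u p') p = A x u p * Real.exp (g x u p) ∧
      -- L_u - L_px - p L_pu = e^g B
      Du (LagL A B g) x u p
        - deriv (fun x' => Dp (LagL A B g) x' u p) x
        - p * deriv (fun u' => Dp (LagL A B g) x u' p) u
        = Real.exp (g x u p) * B x u p := by
  set F : ℝ → ℝ → ℝ → ℝ := fun x u p => A x u p * Real.exp (g x u p)
  have hF : ContDiff ℝ 1 (fun v : ℝ × ℝ × ℝ => F v.1 v.2.1 v.2.2) := hA.mul hgC.exp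
  have hFc : Continuous (fun v : ℝ × ℝ × ℝ => F v.1 v.2.1 v.2.2) := hF.continuous
  have hBc := hB.continuous
  have hgc := hgC.continuous
  obtain ⟨Ax, Au, Ap, -, -, hAx, hAu, -⟩ := exists_continuous_partials hA
  obtain ⟨-, -, Bp, -, -, -, -, hBp⟩ := exists_continuous_partials hB
  obtain ⟨gx, gu, gp, -, -, hgx, hgu, hgp⟩ := exists_continuous_partials hgC
  obtain ⟨Fx, Fu, -, hFxc, hFuc, hFx, hFu, -⟩ := exists_continuous_partials hF
  have hline : ∀ {f : ℝ → ℝ → ℝ → ℝ}, Continuous (fun v : ℝ × ℝ × ℝ => f v.1 v.2.1 v.2.2) →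
      ∀ x u, Continuous (f x u) := fun hf x u =>
    hf.comp (g := fun v : ℝ × ℝ × ℝ => _) (f := fun p : ℝ => (x, u, p)) (by fun_prop)
  have hxp : ∀ {f : ℝ → ℝ → ℝ → ℝ}, Continuous (fun v : ℝ × ℝ × ℝ => f v.1 v.2.1 v.2.2) →
      ∀ u, Continuous (fun x p => f x u p).uncurry := fun hf u =>
    hf.comp (f := fun w : ℝ × ℝ => (w.1, u, w.2)) (by fun_prop)
  have hup : ∀ {f : ℝ → ℝ → ℝ → ℝ}, Continuous (fun v : ℝ × ℝ × ℝ => f v.1 v.2.1 v.2.2) →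
      ∀ x, Continuous (f x).uncurry := fun hf x =>
    hf.comp (f := fun w : ℝ × ℝ => (x, w.1, w.2)) (by fun_prop)
  have hprim : ∀ {f : ℝ → ℝ}, Continuous f → ∀ q,
      HasDerivAt (fun q => ∫ r in (0:ℝ)..q, f r) (f q) q := fun hf q =>
    hf.integral_hasStrictDerivAt 0 q |>.hasDerivAt
  have hinner : ∀ {f : ℝ → ℝ → ℝ → ℝ}, Continuous (fun v : ℝ × ℝ × ℝ => f v.1 v.2.1 v.2.2) →
      ∀ x, Continuous (fun u q => ∫ r in (0:ℝ)..q, f x u r).uncurry := fun hf x =>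
    intervalIntegral.continuous_parametric_primitive_of_continuous (hup hf x)
  have hLp : ∀ x u p, HasDerivAt (fun p' => LagL A B g x u p') (∫ q in (0:ℝ)..p, F x u q) p :=
    fun x u p => (hprim ((hinner hFc x).comp (Continuous.prodMk_right u)) p).add_const _
  have hDp : Dp (LagL A B g) = fun x u p => ∫ q in (0:ℝ)..p, F x u q := by
    funext x u p
    exact (hLp x u p).deriv
  have hsrc : ∀ x, Continuous (fun u => Real.exp (g x u 0) * B x u 0) := fun x =>
    (hgc.rexp.mul hBc).comp (f := fun u : ℝ => (x, u, (0:ℝ))) (by fun_prop)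
  have hLpx : ∀ x u p, HasDerivAt (fun x' => ∫ q in (0:ℝ)..p, F x' u q)
      (∫ q in (0:ℝ)..p, Fx x u q) x := fun x u p =>
    hasDerivAt_intervalIntegral_of_continuous (hxp hFc u) (hxp hFxc u)
      (fun t q => hFx t u q) 0 p x
  have hLpu : ∀ x u p, HasDerivAt (fun u' => ∫ q in (0:ℝ)..p, F x u' q)
      (∫ q in (0:ℝ)..p, Fu x u q) u := fun x u p =>
    hasDerivAt_intervalIntegral_of_continuous (hup hFc x) (hup hFuc x)
      (fun t q => hFu x t q) 0 p u
  have hLu : ∀ x u p, HasDerivAt (fun u' => LagL A B g x u' p)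
      ((∫ q in (0:ℝ)..p, ∫ r in (0:ℝ)..q, Fu x u r) + Real.exp (g x u 0) * B x u 0) u :=
    fun x u p => (hasDerivAt_intervalIntegral_of_continuous (hinner hFc x) (hinner hFuc x)
      (fun t q => hLpu x t q) 0 p u).add (hprim (hsrc x) u)
  intro x hx u p
  have hLpp := hprim (hline hFc x u) p
  rw [hDp]
  refine ⟨(hLu x u p).differentiableAt, (hLp x u p).differentiableAt, hLpp.differentiableAt,
    (hLpx x u p).differentiableAt, (hLpu x u p).differentiableAt, hLpp.deriv, ?_⟩
  rw [(hLpx x u p).deriv, (hLpu x u p).deriv, Du, (hLu x u p).deriv]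
  refine integral_sub_integral_eq_of_hasDerivAt (G := fun p => Real.exp (g x u p) * B x u p)
    (hline hFxc x u) (hline hFuc x u) (fun q => ?_) p
  refine ((hgp x u q).exp.mul (hBp x u q)).congr_deriv ?_
  have hpde := hPDE x hx u q
  simp only [Dx, Du, Dp, (hgx x u q).deriv, (hgu x u q).deriv, (hgp x u q).deriv,
    (hBp x u q).deriv, (hAx x u q).deriv, (hAu x u q).deriv] at hpde
  rw [(hFx x u q).unique ((hAx x u q).mul (hgx x u q).exp),
    (hFu x u q).unique ((hAu x u q).mul (hgu x u q).exp)]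
  linear_combination Real.exp (g x u q) * hpde
end

section
/- Energy for the $\rho$-Laplacian with polynomial gradient reaction. Let $\rho \in \mathbb{R}$ with $\rho \geq 2$ and let $n \in \mathbb{Z}$ with $\rho - n \neq 0$ and $\rho - n \neq 1$. Let $T>0$ and let $u : [0,T]\times[0,1] \to \mathbb{R}$ be twice continuously differentiable with $u_x(t,x) > 0$ for all $(t,x)$, satisfying $u_t = (\rho - 1)\,u_x^{\rho - 2}\,u_{xx} + u_x^{\,n}$ on $[0,T]\times[0,1]$ and $u_t(t,0) = u_t(t,1) = 0$ for all $t$. Then for every $t \in (0,T)$, the energy $E(t) := \int_0^1 \Big( \frac{\rho - 1}{(\rho - n)(\rho - n - 1)}\,u_x(t,x)^{\rho - n} - u(t,x) \Big)\,dx$ is differentiable and $E'(t) = -\int_0^1 \frac{u_t(t,x)^2}{u_x(t,x)^{\,n}}\,dx$. -/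
open Real Set

/-- Differentiation under the integral sign for integrands continuous on a compact rectangle. -/
theorem hasDerivAt_intervalIntegral_of_continuousOn_rect {F F' : ℝ → ℝ → ℝ} {a b t : ℝ}
    (ht : t ∈ Ioo a b)
    (hF : ContinuousOn (fun q : ℝ × ℝ => F q.1 q.2) (Icc a b ×ˢ Icc (0 : ℝ) 1))
    (hF' : ContinuousOn (fun q : ℝ × ℝ => F' q.1 q.2) (Icc a b ×ˢ Icc (0 : ℝ) 1))
    (hderiv : ∀ s ∈ Icc a b, ∀ x ∈ Icc (0 : ℝ) 1,
      HasDerivAt (fun r => F r x) (F' s x) s) :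
    HasDerivAt (fun s => ∫ x in (0 : ℝ)..1, F s x) (∫ x in (0 : ℝ)..1, F' t x) t := by
  have slice : ∀ {G : ℝ → ℝ → ℝ},
      ContinuousOn (fun q : ℝ × ℝ => G q.1 q.2) (Icc a b ×ˢ Icc (0 : ℝ) 1) →
      ∀ s ∈ Icc a b, IntervalIntegrable (G s) MeasureTheory.volume 0 1 := by
    intro G hG s hs
    apply ContinuousOn.intervalIntegrable_of_Icc zero_le_one
    exact hG.comp (f := fun x : ℝ => (s, x)) (by fun_prop) fun x hx => ⟨hs, hx⟩
  obtain ⟨C, hC⟩ := (isCompact_Icc.prod isCompact_Icc).exists_bound_of_continuousOn hF'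
  have hnhds : Icc a b ∈ nhds t := Icc_mem_nhds ht.1 ht.2
  have hsub : ∀ x ∈ uIoc (0 : ℝ) 1, x ∈ Icc (0 : ℝ) 1 := by
    intro x hx
    rw [uIoc_of_le zero_le_one] at hx
    exact ⟨hx.1.le, hx.2⟩
  refine (intervalIntegral.hasDerivAt_integral_of_dominated_loc_of_deriv_le
    (bound := fun _ => C) hnhds ?_ (slice hF t (Ioo_subset_Icc_self ht)) ?_ ?_
    intervalIntegrable_const ?_).2
  · filter_upwards [hnhds] with s hs
    exact (slice hF s hs).def'.aestronglyMeasurable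
  · exact (slice hF' t (Ioo_subset_Icc_self ht)).def'.aestronglyMeasurable
  · exact Filter.Eventually.of_forall fun x hx s hs => hC (s, x) ⟨hs, hsub x hx⟩
  · exact Filter.Eventually.of_forall fun x hx s hs => hderiv s hs x (hsub x hx)

/-- The first-variable slice of a differentiable function of two variables is
differentiable in that variable. -/
theorem hasDerivAt_fst_slice {f : ℝ × ℝ → ℝ} (hf : Differentiable ℝ f) (t x : ℝ) :
    HasDerivAt (fun s => f (s, x)) (fderiv ℝ f (t, x) (1, 0)) t :=
  (hf (t, x)).hasFDerivAt.comp_hasDerivAt t ((hasDerivAt_id t).prodMk (hasDerivAt_const t x))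

/-- The second-variable slice of a differentiable function of two variables is
differentiable in that variable. -/
theorem hasDerivAt_snd_slice {f : ℝ × ℝ → ℝ} (hf : Differentiable ℝ f) (t x : ℝ) :
    HasDerivAt (fun y => f (t, y)) (fderiv ℝ f (t, x) (0, 1)) x :=
  (hf (t, x)).hasFDerivAt.comp_hasDerivAt x ((hasDerivAt_const x t).prodMk (hasDerivAt_id x))

/-- For `u` of class `C²`, both first partials are differentiable in each variable, with a common
continuous mixed second partial. -/
theorem exists_mixed_partial {u : ℝ → ℝ → ℝ}
    (hu : ContDiff ℝ 2 (fun q : ℝ × ℝ => u q.1 q.2)) :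
    ∃ m : ℝ → ℝ → ℝ, Continuous (fun q : ℝ × ℝ => m q.1 q.2) ∧
      Continuous (fun q : ℝ × ℝ => pt u q.1 q.2) ∧
      Continuous (fun q : ℝ × ℝ => px u q.1 q.2) ∧
      Continuous (fun q : ℝ × ℝ => pxx u q.1 q.2) ∧
      (∀ t x, HasDerivAt (fun s => u s x) (pt u t x) t) ∧
      (∀ t x, HasDerivAt (fun y => px u t y) (pxx u t x) x) ∧
      (∀ t x, HasDerivAt (fun s => px u s x) (m t x) t) ∧
      (∀ t x, HasDerivAt (fun y => pt u t y) (m t x) x) := by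
  set U : ℝ × ℝ → ℝ := fun q => u q.1 q.2 with hU
  have hdU : Differentiable ℝ U := hu.differentiable (by norm_num)
  have hfd : ContDiff ℝ 1 (fderiv ℝ U) := hu.fderiv_right (by norm_num)
  have happ : ∀ v : ℝ × ℝ, ContDiff ℝ 1 (fun q => fderiv ℝ U q v) := fun v =>
    hfd.clm_apply contDiff_const
  have hdapp : ∀ v : ℝ × ℝ, Differentiable ℝ (fun q => fderiv ℝ U q v) := fun v =>
    (happ v).differentiable (by norm_num)
  have hcapp : ∀ v w : ℝ × ℝ, Continuous (fun q => fderiv ℝ (fun q => fderiv ℝ U q v) q w) :=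
    fun v w => ((happ v).continuous_fderiv (by norm_num)).clm_apply continuous_const
  have hpt : ∀ t x, pt u t x = fderiv ℝ U (t, x) (1, 0) := fun t x =>
    (hasDerivAt_fst_slice hdU t x).deriv
  have hpx : ∀ t x, px u t x = fderiv ℝ U (t, x) (0, 1) := fun t x =>
    (hasDerivAt_snd_slice hdU t x).deriv
  have hpxx : ∀ t x, HasDerivAt (fun y => px u t y)
      (fderiv ℝ (fun q => fderiv ℝ U q (0, 1)) (t, x) (0, 1)) x := by
    intro t x
    simp only [hpx]
    exact hasDerivAt_snd_slice (hdapp (0, 1)) t x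
  have happly : ∀ q v w, fderiv ℝ (fun q => fderiv ℝ U q v) q w
      = fderiv ℝ (fderiv ℝ U) q w v := by
    intro q v w
    have h := ((hfd.differentiable (by norm_num)) q).hasFDerivAt.clm_apply
      (hasFDerivAt_const v q)
    rw [h.fderiv]
    simp
  have hsymm : ∀ q, fderiv ℝ (fun q => fderiv ℝ U q (1, 0)) q (0, 1)
      = fderiv ℝ (fun q => fderiv ℝ U q (0, 1)) q (1, 0) := by
    intro q
    rw [happly, happly]
    exact (hu.contDiffAt.isSymmSndFDerivAt (by simp)) _ _
  refine ⟨fun t x => fderiv ℝ (fun q => fderiv ℝ U q (0, 1)) (t, x) (1, 0),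
    hcapp _ _, ?_, ?_, ?_, ?_, ?_, ?_, ?_⟩
  · simp only [hpt]
    exact (happ _).continuous
  · simp only [hpx]
    exact (happ _).continuous
  · have : (fun q : ℝ × ℝ => pxx u q.1 q.2)
        = fun q => fderiv ℝ (fun q => fderiv ℝ U q (0, 1)) q (0, 1) :=
      funext fun q => (hpxx q.1 q.2).deriv
    rw [this]
    exact hcapp _ _
  · intro t x
    rw [hpt]
    exact hasDerivAt_fst_slice hdU t x
  · intro t x
    have h := hpxx t x
    rwa [← h.deriv] at h
  · intro t x
    simp only [hpx]
    exact hasDerivAt_fst_slice (hdapp (0, 1)) t x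
  · intro t x
    simp only [← hsymm, hpt]
    exact hasDerivAt_snd_slice (hdapp (1, 0)) t x

/-- Energy for the ρ-Laplacian with polynomial gradient reaction. -/
theorem energy_rho_laplacian_polynomial_reaction
    (ρ : ℝ) (hρ : 2 ≤ ρ)
    (n : ℤ) (hn0 : ρ - n ≠ 0) (hn1 : ρ - n ≠ 1)
    (T : ℝ) (hT : 0 < T)
    (u : ℝ → ℝ → ℝ)
    (hu : ContDiff ℝ 2 (fun q : ℝ × ℝ => u q.1 q.2))
    (hpos : ∀ t ∈ Icc (0:ℝ) T, ∀ x ∈ Icc (0:ℝ) 1, 0 < px u t x)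
    (hPDE : ∀ t ∈ Icc (0:ℝ) T, ∀ x ∈ Icc (0:ℝ) 1,
      pt u t x = (ρ - 1) * (px u t x) ^ (ρ - 2) * pxx u t x + (px u t x) ^ n)
    (hBC : ∀ t ∈ Icc (0:ℝ) T, pt u t 0 = 0 ∧ pt u t 1 = 0) :
    ∀ t ∈ Ioo (0:ℝ) T,
      HasDerivAt
        (fun s => ∫ x in (0:ℝ)..1,
          ((ρ - 1) / ((ρ - n) * (ρ - n - 1)) * (px u s x) ^ (ρ - n) - u s x))
        (-∫ x in (0:ℝ)..1, (pt u t x) ^ 2 / (px u t x) ^ n) t := by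
  intro t ht
  obtain ⟨m, hmc, hptc, hpxc, hpxxc, hut, hpxx, hpxt, hptx⟩ := exists_mixed_partial hu
  have htI : t ∈ Icc (0 : ℝ) T := Ioo_subset_Icc_self ht
  have hn1' : ρ - n - 1 ≠ 0 := sub_ne_zero.mpr hn1
  have hpow : ∀ r : ℝ, ContinuousOn (fun q : ℝ × ℝ => px u q.1 q.2 ^ r)
      (Icc 0 T ×ˢ Icc (0 : ℝ) 1) := fun r =>
    hpxc.continuousOn.rpow_const fun q hq => Or.inl (hpos q.1 hq.1 q.2 hq.2).ne'
  have hE := hasDerivAt_intervalIntegral_of_continuousOn_rect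
    (F := fun s x => (ρ - 1) / ((ρ - n) * (ρ - n - 1)) * (px u s x) ^ (ρ - n) - u s x)
    (F' := fun s x => (ρ - 1) / (ρ - n - 1) * (px u s x) ^ (ρ - n - 1) * m s x - pt u s x) ht
    ((continuousOn_const.mul (hpow _)).sub hu.continuous.continuousOn)
    (((continuousOn_const.mul (hpow _)).mul hmc.continuousOn).sub hptc.continuousOn)
    (by
      intro s hs x hx
      have h := (((hpxt s x).rpow_const (p := ρ - n)
        (Or.inl (hpos s hs x hx).ne')).const_mul
          ((ρ - 1) / ((ρ - n) * (ρ - n - 1)))).sub (hut s x)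
      refine h.congr_deriv ?_
      field_simp)
  convert hE using 1
  have hslice : ∀ {G : ℝ × ℝ → ℝ}, ContinuousOn G (Icc 0 T ×ˢ Icc (0 : ℝ) 1) →
      IntervalIntegrable (fun x => G (t, x)) MeasureTheory.volume 0 1 := fun hG =>
    (hG.comp (f := fun x : ℝ => (t, x)) (by fun_prop)
      fun x hx => ⟨htI, hx⟩).intervalIntegrable_of_Icc zero_le_one
  have hg'c : ContinuousOn
      (fun q : ℝ × ℝ => (ρ - 1) * px u q.1 q.2 ^ (ρ - n - 2) * pxx u q.1 q.2)
      (Icc 0 T ×ˢ Icc (0 : ℝ) 1) :=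
    (continuousOn_const.mul (hpow _)).mul hpxxc.continuousOn
  have hparts := intervalIntegral.integral_mul_deriv_eq_deriv_mul (a := 0) (b := 1)
    (u := fun x => (ρ - 1) / (ρ - n - 1) * px u t x ^ (ρ - n - 1))
    (u' := fun x => (ρ - 1) * px u t x ^ (ρ - n - 2) * pxx u t x)
    (v := fun x => pt u t x) (v' := fun x => m t x)
    (by
      intro x hx
      rw [uIcc_of_le zero_le_one] at hx
      have h := ((hpxx t x).rpow_const (p := ρ - n - 1)
        (Or.inl (hpos t htI x hx).ne')).const_mul ((ρ - 1) / (ρ - n - 1))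
      refine h.congr_deriv ?_
      rw [show ρ - n - 1 - 1 = ρ - n - 2 by ring]
      field_simp)
    (fun x _ => hptx t x) (hslice hg'c) (hslice hmc.continuousOn)
  rw [(hBC t htI).1, (hBC t htI).2] at hparts
  have hgm : IntervalIntegrable
      (fun x => (ρ - 1) / (ρ - n - 1) * px u t x ^ (ρ - n - 1) * m t x)
      MeasureTheory.volume 0 1 :=
    hslice ((continuousOn_const.mul (hpow _)).mul hmc.continuousOn)
  have hg'ut : IntervalIntegrable
      (fun x => (ρ - 1) * px u t x ^ (ρ - n - 2) * pxx u t x * pt u t x)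
      MeasureTheory.volume 0 1 :=
    hslice (hg'c.mul hptc.continuousOn)
  have hpti : IntervalIntegrable (fun x => pt u t x) MeasureTheory.volume 0 1 :=
    hslice hptc.continuousOn
  rw [intervalIntegral.integral_sub hgm hpti, hparts, mul_zero, mul_zero, sub_zero, zero_sub,
    ← neg_add', ← intervalIntegral.integral_add hg'ut hpti]
  congr 1
  refine intervalIntegral.integral_congr fun x hx => ?_
  rw [uIcc_of_le zero_le_one] at hx
  have hp := hpos t htI x hx
  have hsplit : px u t x ^ (ρ - n - 2) = px u t x ^ (ρ - 2) / px u t x ^ n := by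
    rw [show ρ - n - 2 = ρ - 2 - n by ring, rpow_sub hp, rpow_intCast]
  have hz : px u t x ^ n ≠ 0 := (zpow_pos hp n).ne'
  simp only [hsplit]
  rw [div_eq_iff hz]
  field_simp
  linear_combination (pt u t x) * hPDE t htI x hx
end
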